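/- arXiv:2503.20438 — 5 statements merged into one kernel-verified Lean document; each statement's English description precedes it below -/
import Mathlib

section
/- Let k be a positive integer, let G = (V,E) be a finite simple graph, and let W ⊆ V be a set of 2k+1 vertices of G having no balanced k-separator. Suppose (X,Y) is a W-balanced partition of V. Then G contains an (X,Y)-matching of size ⌊k/3⌋. -/
/-- The set of vertices of `V` lying in the connected component `C` of the subgraph of `G`
induced on the complement of `S`. -/
def componentSupp {V : Type*} (G : SimpleGraph V) (S : Set V)
    (C : (G.induce Sᶜ).ConnectedComponent) : Set V :=
  {v : V | ∃ h : v ∈ Sᶜ, (G.induce Sᶜ).connectedComponentMk ⟨v, h⟩ = C}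

/-- `S` is a balanced separator of `G` with respect to `W`: every connected component `C`
of the subgraph induced on `V ∖ S` satisfies `|C ∩ W| ≤ |W| / 2`. -/
def IsBalancedSeparator {V : Type*} (G : SimpleGraph V) (W S : Set V) : Prop :=
  ∀ C : (G.induce Sᶜ).ConnectedComponent,
    2 * (componentSupp G S C ∩ W).ncard ≤ W.ncard

/-- `(X, Y)` is a `W`-balanced partition of the vertex set:
`X ∪ Y = V`, `X ∩ Y = ∅` and `min(|X ∩ W|, |Y ∩ W|) ≥ |W| / 3`. -/
def IsWBalancedPartition {V : Type*} (W X Y : Set V) : Prop :=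
  X ∪ Y = Set.univ ∧ Disjoint X Y ∧
    W.ncard ≤ 3 * (X ∩ W).ncard ∧ W.ncard ≤ 3 * (Y ∩ W).ncard

/-- `G` contains an `(X, Y)`-matching of size `m`: a set of `m` pairwise vertex-disjoint
edges of `G`, each with one endpoint in `X` and the other in `Y`. -/
def HasXYMatching {V : Type*} (G : SimpleGraph V) (X Y : Set V) (m : ℕ) : Prop :=
  ∃ f : Fin m → V × V,
    (∀ i, (f i).1 ∈ X ∧ (f i).2 ∈ Y ∧ G.Adj (f i).1 (f i).2) ∧
    ∀ i j, i ≠ j →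
      (f i).1 ≠ (f j).1 ∧ (f i).1 ≠ (f j).2 ∧ (f i).2 ≠ (f j).1 ∧ (f i).2 ≠ (f j).2

open Classical in
/-- Koenig: either a matching of size `m`, or a cover of the `X`-`Y` edges of size `< m`. -/
theorem koenig_aux {V : Type*} [Fintype V] (G : SimpleGraph V) (X Y : Set V) (hd : Disjoint X Y)
    (m : ℕ) (hno : ¬ HasXYMatching G X Y m) :
    ∃ S : Set V, S.ncard < m ∧ ∀ x ∈ X, ∀ y ∈ Y, G.Adj x y → x ∈ S ∨ y ∈ S := by
  by_cases hm : X.ncard < m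
  · exact ⟨X, hm, fun x hx _ _ _ => Or.inl hx⟩
  push Not at hm
  let N : X → Finset V := fun x => Finset.univ.filter (fun y => y ∈ Y ∧ G.Adj x y)
  let d := X.ncard - m
  let t : X → Finset (V ⊕ Fin d) := fun x => (N x).disjSum Finset.univ
  have hXc : Fintype.card X = X.ncard := by
    rw [← Nat.card_eq_fintype_card, Nat.card_coe_set_eq]
  by_cases hall : ∀ s : Finset X, s.card ≤ (s.biUnion t).card
  · exfalso
    apply hno
    obtain ⟨f, hf, hft⟩ := (Finset.all_card_le_biUnion_card_iff_exists_injective t).1 hall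
    let A : Finset X := Finset.univ.filter (fun x => (f x).isLeft = true)
    let B : Finset X := Finset.univ.filter (fun x => ¬ (f x).isLeft = true)
    have hAB : A.card + B.card = Fintype.card X := by
      simpa [A, B] using Finset.card_filter_add_card_filter_not
        (s := (Finset.univ : Finset X)) (fun x => (f x).isLeft = true)
    have hB : B.card ≤ d := by
      have h1 : B.image f ⊆ Finset.univ.image (Sum.inr : Fin d → V ⊕ Fin d) := by
        intro z hz
        simp only [B, Finset.mem_image, Finset.mem_filter, Finset.mem_univ, true_and] at hz ⊢
        obtain ⟨x, hx, rfl⟩ := hz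
        rcases h : f x with a | b
        · simp [h] at hx
        · exact ⟨b, rfl⟩
      have h2 := Finset.card_le_card h1
      rw [Finset.card_image_of_injective _ hf,
        Finset.card_image_of_injective _ Sum.inr_injective] at h2
      simpa using h2
    have hA : m ≤ A.card := by omega
    obtain ⟨A', hA', hA'c⟩ := Finset.exists_subset_card_eq hA
    let e : Fin m ≃ A' := (Finset.equivFinOfCardEq hA'c).symm
    have hg : ∀ x : A', ∃ y : V, f x.1 = Sum.inl y := by
      intro x
      have := hA' x.2
      simp only [A, Finset.mem_filter, Finset.mem_univ, true_and] at this
      exact Sum.isLeft_iff.1 this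
    choose g hg using hg
    have hgm : ∀ x : A', g x ∈ Y ∧ G.Adj x.1.1 (g x) := by
      intro x
      have := hft x.1
      rw [hg] at this
      simpa [t, N] using this
    have hne : ∀ x ∈ X, ∀ y ∈ Y, x ≠ y := fun x hx y hy h =>
      Set.disjoint_left.1 hd hx (h ▸ hy)
    refine ⟨fun i => ((e i).1.1, g (e i)), fun i => ⟨(e i).1.2, hgm _⟩, fun i j hij => ?_⟩
    have h1 : (e i) ≠ e j := fun h => hij (e.injective h)
    refine ⟨fun h => h1 (Subtype.ext (Subtype.ext h)), hne _ (e i).1.2 _ (hgm _).1,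
      (hne _ (e j).1.2 _ (hgm _).1).symm, fun h => ?_⟩
    apply h1
    apply Subtype.ext
    apply hf
    rw [hg, hg]
    exact congrArg _ h
  · push Not at hall
    obtain ⟨s, hs⟩ := hall
    have hsne : s.Nonempty := by
      rw [Finset.nonempty_iff_ne_empty]
      rintro rfl
      simp at hs
    have hb : s.biUnion t = (s.biUnion N).disjSum Finset.univ := by
      ext z
      obtain ⟨w, hw⟩ := hsne
      rcases z with a | b
      · simp [t]
      · simp only [t, Finset.mem_biUnion, Finset.inr_mem_disjSum, Finset.mem_univ, and_true,
          iff_true]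
        exact ⟨w, hw⟩
    rw [hb, Finset.card_disjSum] at hs
    simp only [Finset.card_univ, Fintype.card_fin] at hs
    let F : Finset V := (sᶜ).image Subtype.val ∪ s.biUnion N
    refine ⟨(F : Set V), ?_, ?_⟩
    · rw [Set.ncard_coe_finset]
      have h1 : F.card ≤ _ := Finset.card_union_le _ _
      have h2 : ((sᶜ).image (Subtype.val : X → V)).card ≤ _ := Finset.card_image_le
      have h3 := Finset.card_add_card_compl s
      omega
    · intro x hx y hy hxy
      by_cases hxs : (⟨x, hx⟩ : X) ∈ s
      · right
        simp only [F, Finset.coe_union, Set.mem_union, Finset.mem_coe]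
        right
        exact Finset.mem_biUnion.2 ⟨_, hxs, by simp [N, hy, hxy]⟩
      · left
        simp only [F, Finset.coe_union, Set.mem_union, Finset.mem_coe]
        left
        exact Finset.mem_image.2 ⟨⟨x, hx⟩, by simpa using hxs, rfl⟩

/-- From a small cover of the crossing edges, build a balanced `k`-separator. -/
theorem separator_aux {V : Type*} [Fintype V] (G : SimpleGraph V) (k : ℕ)
    (W : Set V) (hWcard : W.ncard = 2 * k + 1) (X Y S0 : Set V)
    (hU : X ∪ Y = Set.univ) (hd : Disjoint X Y)
    (hY3 : W.ncard ≤ 3 * (Y ∩ W).ncard) (hYk : (Y ∩ W).ncard ≤ k)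
    (hS0 : S0.ncard < k / 3)
    (hcov : ∀ x ∈ X, ∀ y ∈ Y, G.Adj x y → x ∈ S0 ∨ y ∈ S0) :
    ∃ S : Set V, S.ncard ≤ k ∧ IsBalancedSeparator G W S := by
  have hsum : (X ∩ W).ncard + (Y ∩ W).ncard = W.ncard := by
    rw [← Set.ncard_union_eq (hd.mono Set.inter_subset_left Set.inter_subset_left)
      (Set.toFinite _) (Set.toFinite _), ← Set.union_inter_distrib_right, hU, Set.univ_inter]
  obtain ⟨T, hT, hTc⟩ := Set.exists_subset_card_eq
    (s := X ∩ W) (n := (X ∩ W).ncard - k) (by omega)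
  refine ⟨S0 ∪ T, ?_, ?_⟩
  · have := Set.ncard_union_le S0 T
    omega
  · intro C
    have key : ∀ u v : ((S0 ∪ T)ᶜ : Set V), (G.induce (S0 ∪ T)ᶜ).Reachable u v →
        (u.1 ∈ X ↔ v.1 ∈ X) := by
      have hmem : ∀ v : V, v ∉ X → v ∈ Y := by
        intro v hv
        have : v ∈ X ∪ Y := hU ▸ Set.mem_univ v
        exact this.resolve_left hv
      have step : ∀ u v : ((S0 ∪ T)ᶜ : Set V), G.Adj u.1 v.1 → u.1 ∈ X → v.1 ∈ X := by
        intro u v huv hu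
        by_contra hv
        rcases hcov _ hu _ (hmem _ hv) huv with h | h
        · exact u.2 (Or.inl h)
        · exact v.2 (Or.inl h)
      rintro u v ⟨p⟩
      induction p with
      | nil => rfl
      | cons h p ih =>
        rw [← ih]
        have h' := SimpleGraph.comap_adj.1 h
        exact ⟨step _ _ h', step _ _ h'.symm⟩
    induction C using SimpleGraph.ConnectedComponent.ind with
    | h u =>
    by_cases hu : u.1 ∈ X
    · have hsub : componentSupp G (S0 ∪ T) (SimpleGraph.connectedComponentMk _ u) ∩ W
          ⊆ (X ∩ W) \ T := by
        rintro v ⟨⟨hv, hvC⟩, hvW⟩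
        have := key _ _ (SimpleGraph.ConnectedComponent.exact hvC)
        exact ⟨⟨this.2 hu, hvW⟩, fun h => hv (Or.inr h)⟩
      have h1 := Set.ncard_le_ncard hsub (Set.toFinite _)
      have h2 := Set.ncard_sdiff_add_ncard_of_subset hT (Set.toFinite _)
      omega
    · have hsub : componentSupp G (S0 ∪ T) (SimpleGraph.connectedComponentMk _ u) ∩ W
          ⊆ Y ∩ W := by
        rintro v ⟨⟨hv, hvC⟩, hvW⟩
        have := key _ _ (SimpleGraph.ConnectedComponent.exact hvC)
        have h3 : v ∈ X ∪ Y := hU ▸ Set.mem_univ v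
        exact ⟨h3.resolve_left (fun h => hu (this.1 h)), hvW⟩
      have h1 := Set.ncard_le_ncard hsub (Set.toFinite _)
      omega

/-- If `W` is a set of `2k+1` vertices with no balanced `k`-separator and `(X, Y)` is a
`W`-balanced partition, then `G` contains an `(X, Y)`-matching of size `⌊k/3⌋`. -/
theorem matching_of_no_balanced_separator {V : Type*} [Fintype V]
    (G : SimpleGraph V) (k : ℕ) (hk : 0 < k)
    (W : Set V) (hWcard : W.ncard = 2 * k + 1)
    (hW : ¬ ∃ S : Set V, S.ncard ≤ k ∧ IsBalancedSeparator G W S)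
    (X Y : Set V) (hXY : IsWBalancedPartition W X Y) :
    HasXYMatching G X Y (k / 3) := by
  by_contra hno
  obtain ⟨hU, hd, hX3, hY3⟩ := hXY
  obtain ⟨S0, hS0, hcov⟩ := koenig_aux G X Y hd _ hno
  have hsum : (X ∩ W).ncard + (Y ∩ W).ncard = W.ncard := by
    rw [← Set.ncard_union_eq (hd.mono Set.inter_subset_left Set.inter_subset_left)
      (Set.toFinite _) (Set.toFinite _), ← Set.union_inter_distrib_right, hU, Set.univ_inter]
  apply hW
  by_cases hYk : (Y ∩ W).ncard ≤ k
  · exact separator_aux G k W hWcard X Y S0 hU hd hY3 hYk hS0 hcov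
  · exact separator_aux G k W hWcard Y X S0 (by rw [Set.union_comm, hU]) hd.symm hX3 (by omega) hS0
      (fun y hy x hx h => (hcov x hx y hy h.symm).symm)
end

section
/- Let k be a positive integer, let G = (V,E) be a finite simple graph, and let W ⊆ V be a set of 2k+1 vertices of G having no balanced k-separator. Suppose (X,Y) is a W-balanced partition of V. Then for every set S' ⊆ V with |S'| ≤ ⌊2k/3⌋ there exists a connected component of the subgraph of G induced on V ∖ S' that contains both a vertex of X and a vertex of Y. -/
theorem componentSupp_sub {V : Type*} (G : SimpleGraph V) {S' S : Set V} (h : S' ⊆ S)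
    (C : (G.induce Sᶜ).ConnectedComponent) :
    ∃ D : (G.induce S'ᶜ).ConnectedComponent, componentSupp G S C ⊆ componentSupp G S' D := by
  have hc : Sᶜ ⊆ S'ᶜ := Set.compl_subset_compl.mpr h
  refine ⟨C.map (SimpleGraph.induceHomOfLE G hc).toHom, ?_⟩
  rintro v ⟨hv, rfl⟩
  exact ⟨hc hv, rfl⟩

theorem meets_aux {V : Type*} [Fintype V]
    (G : SimpleGraph V) (k : ℕ)
    (W : Set V) (hWcard : W.ncard = 2 * k + 1)
    (hW : ¬ ∃ S : Set V, S.ncard ≤ k ∧ IsBalancedSeparator G W S)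
    (X Y : Set V) (hXY : IsWBalancedPartition W X Y) (hX : (X ∩ W).ncard ≤ k)
    (S' : Set V) (hS : S'.ncard ≤ 2 * k / 3) :
      ∃ C : (G.induce S'ᶜ).ConnectedComponent,
        (componentSupp G S' C ∩ X).Nonempty ∧ (componentSupp G S' C ∩ Y).Nonempty := by
  by_contra hne
  obtain ⟨hU, hD, h1, h2⟩ := hXY
  have hsum : (X ∩ W).ncard + (Y ∩ W).ncard = 2 * k + 1 := by
    rw [← hWcard, ← Set.ncard_union_eq
      (hD.mono Set.inter_subset_left Set.inter_subset_left) (Set.toFinite _) (Set.toFinite _),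
      ← Set.union_inter_distrib_right, hU, Set.univ_inter]
  obtain ⟨T, hT, hTc⟩ := Set.exists_subset_card_eq (s := Y ∩ W) (n := k - S'.ncard) (by omega)
  apply hW
  refine ⟨S' ∪ T, ?_, ?_⟩
  · have := Set.ncard_union_le S' T
    omega
  · intro C
    obtain ⟨D, hCD⟩ := componentSupp_sub G (Set.subset_union_left : S' ⊆ S' ∪ T) C
    have hside : componentSupp G (S' ∪ T) C ∩ W ⊆ X ∩ W ∨
        componentSupp G (S' ∪ T) C ∩ W ⊆ (Y ∩ W) \ T := by
      by_cases hx : (componentSupp G S' D ∩ X).Nonempty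
      · left
        rintro v ⟨hv, hw⟩
        have : v ∈ X ∪ Y := hU ▸ Set.mem_univ v
        rcases this with h | h
        · exact ⟨h, hw⟩
        · exact absurd ⟨D, hx, v, hCD hv, h⟩ hne
      · right
        rintro v ⟨hv, hw⟩
        have : v ∈ X ∪ Y := hU ▸ Set.mem_univ v
        rcases this with h | h
        · exact absurd ⟨v, hCD hv, h⟩ hx
        · refine ⟨⟨h, hw⟩, fun ht => ?_⟩
          obtain ⟨hv', _⟩ := hv
          exact hv' (Or.inr ht)
    rcases hside with h | h
    · have := Set.ncard_le_ncard h (Set.toFinite _)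
      omega
    · have := Set.ncard_le_ncard h (Set.toFinite _)
      have h3 := Set.ncard_sdiff_add_ncard_of_subset hT (Set.toFinite _)
      omega

/-- If `W` is a set of `2k+1` vertices with no balanced `k`-separator and `(X, Y)` is a
`W`-balanced partition, then for every `S'` with `|S'| ≤ ⌊2k/3⌋` some connected component
of the graph induced on `V ∖ S'` contains both a vertex of `X` and a vertex of `Y`. -/
theorem component_meets_both_sides_of_no_balanced_separator {V : Type*} [Fintype V]
    (G : SimpleGraph V) (k : ℕ) (hk : 0 < k)
    (W : Set V) (hWcard : W.ncard = 2 * k + 1)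
    (hW : ¬ ∃ S : Set V, S.ncard ≤ k ∧ IsBalancedSeparator G W S)
    (X Y : Set V) (hXY : IsWBalancedPartition W X Y) :
    ∀ S' : Set V, S'.ncard ≤ 2 * k / 3 →
      ∃ C : (G.induce S'ᶜ).ConnectedComponent,
        (componentSupp G S' C ∩ X).Nonempty ∧ (componentSupp G S' C ∩ Y).Nonempty := by
  intro S' hS
  have hXY' := hXY
  obtain ⟨hU, hD, h1, h2⟩ := hXY'
  have hsum : (X ∩ W).ncard + (Y ∩ W).ncard = 2 * k + 1 := by
    rw [← hWcard, ← Set.ncard_union_eq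
      (hD.mono Set.inter_subset_left Set.inter_subset_left) (Set.toFinite _) (Set.toFinite _),
      ← Set.union_inter_distrib_right, hU, Set.univ_inter]
  by_cases hX : (X ∩ W).ncard ≤ k
  · exact meets_aux G k W hWcard hW X Y hXY hX S' hS
  · obtain ⟨C, hC1, hC2⟩ := meets_aux G k W hWcard hW Y X
      ⟨by rw [Set.union_comm, hU], hD.symm, h2, h1⟩ (by omega) S' hS
    exact ⟨C, hC2, hC1⟩
end

section
/- For every positive integer t there exist a real constant c_t > 0 and a natural number n₀ such that for every integer n ≥ n₀ there is a finite simple graph H on n vertices satisfying: (1) H has at least n²/8 edges; (2) H contains no complete bipartite subgraph K_{a,a} for any integer a ≥ 3·log₂(n); and (3) the number of cliques of size t in H is at least c_t · n^t. -/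
/-- `H` contains a complete bipartite subgraph `K_{a,a}`. -/
def ContainsBiclique {U : Type*} (H : SimpleGraph U) (a : ℕ) : Prop :=
  ∃ A B : Finset U, Disjoint A B ∧ A.card = a ∧ B.card = a ∧
    ∀ u ∈ A, ∀ v ∈ B, H.Adj u v

open Finset in
theorem card_supersets {α : Type*} [Fintype α] [DecidableEq α] (T : Finset α) :
    ((univ.filter (fun w : Finset α => T ⊆ w)).card : ℝ) =
      2 ^ Fintype.card α * (1 / 2) ^ T.card := by
  have h1 : univ.filter (fun w : Finset α => T ⊆ w) = Icc T univ := by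
    ext w; simp
  rw [h1, card_Icc_finset (subset_univ T), card_univ]
  have hle : T.card ≤ Fintype.card α := card_le_univ T
  obtain ⟨k, hk⟩ := Nat.exists_eq_add_of_le hle
  rw [hk, Nat.add_sub_cancel_left, pow_add]
  push_cast
  rw [mul_comm, ← mul_assoc, ← mul_pow]
  norm_num

open Finset in
theorem pair_image_card {α : Type*} [DecidableEq α] (A B : Finset α) (h : Disjoint A B) :
    ((A ×ˢ B).image (fun x => s(x.1, x.2))).card = A.card * B.card := by
  rw [card_image_of_injOn, card_product]
  rintro ⟨a, b⟩ hab ⟨c, d⟩ hcd heq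
  simp only [coe_product, Set.mem_prod, mem_coe] at hab hcd
  simp only [Sym2.eq_iff] at heq
  rcases heq with ⟨h1, h2⟩ | ⟨h1, h2⟩
  · simp [h1, h2]
  · exfalso
    exact disjoint_left.mp h hab.1 (h1 ▸ hcd.2)

/-- contradiction inequality -/
theorem final_arith (C N p n q c y : ℝ) (hC : 0 < C) (hN : 0 < N) (hp : 0 < p) (hn : 4 ≤ n)
    (hnp : 64 ≤ n * p) (hc : c * q ≤ C * p / 64) (hy : y ≤ N / n)
    (h : N * C * p * (n * (n - 1) / 4 - n ^ 2 / 8) ≤ C * n ^ 2 * y + N * (c * q * n ^ 2)) :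
    False := by
  have hn0 : 0 < n := by linarith
  have h1 : n ^ 2 / 16 ≤ n * (n - 1) / 4 - n ^ 2 / 8 := by nlinarith
  have hyb : y ≤ N * p / 64 := by
    refine hy.trans ?_
    rw [div_le_div_iff₀ hn0 (by norm_num)]
    nlinarith
  have hNCp : 0 < N * C * p := by positivity
  have h2 := mul_le_mul_of_nonneg_left h1 hNCp.le
  have h3 : C * n ^ 2 * y ≤ C * n ^ 2 * (N * p / 64) := by gcongr
  have h4 : N * (c * q * n ^ 2) ≤ N * (C * p / 64 * n ^ 2) := by gcongr
  have h5 : 0 < N * C * p * n ^ 2 := by positivity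
  nlinarith

section
open Finset

/-- the sets whose all pairs (incl. diagonal) lie in w -/
def cliq {n : ℕ} (t : ℕ) (w : Finset (Sym2 (Fin n))) : Finset (Finset (Fin n)) :=
  (powersetCard t univ).filter (fun S => S.sym2 ⊆ w)

/-- the nondiagonal pairs in w -/
def edg {n : ℕ} (w : Finset (Sym2 (Fin n))) : Finset (Sym2 (Fin n)) :=
  (univ.filter (fun d : Sym2 (Fin n) => ¬ d.IsDiag)).filter (fun d => d ∈ w)

/-- w contains all pairs of some A,B -/
def badPairs {n : ℕ} (a : ℕ) (w : Finset (Sym2 (Fin n))) : Prop :=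
  ∃ AB ∈ (powersetCard a (univ : Finset (Fin n))) ×ˢ (powersetCard a (univ : Finset (Fin n))),
    Disjoint AB.1 AB.2 ∧ (AB.1 ×ˢ AB.2).image (fun x => s(x.1, x.2)) ⊆ w

theorem nondiag_card (n : ℕ) :
    (univ.filter (fun d : Sym2 (Fin n) => ¬ d.IsDiag)).card = n.choose 2 := by
  have := Sym2.card_subtype_not_diag (α := Fin n)
  rw [Fintype.card_subtype, Fintype.card_fin] at this
  exact this

theorem choose_two_real (n : ℕ) : ((n.choose 2 : ℕ) : ℝ) = n * (n - 1) / 2 := by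
  exact Nat.cast_choose_two ℝ n

theorem sum_cliq (n t : ℕ) :
    ∑ w : Finset (Sym2 (Fin n)), ((cliq t w).card : ℝ) =
      2 ^ Fintype.card (Sym2 (Fin n)) * (n.choose t) * (1 / 2) ^ ((t + 1).choose 2) := by
  simp only [cliq, card_filter, Nat.cast_sum]
  rw [sum_comm]
  have : ∀ S ∈ powersetCard t (univ : Finset (Fin n)),
      ∑ w : Finset (Sym2 (Fin n)), (((if S.sym2 ⊆ w then 1 else 0 : ℕ)) : ℝ) =
       2 ^ Fintype.card (Sym2 (Fin n)) * (1 / 2) ^ ((t + 1).choose 2) := by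
    intro S hS
    rw [← Nat.cast_sum, ← card_filter, card_supersets, card_sym2, (mem_powersetCard.mp hS).2]
  rw [sum_congr rfl this, sum_const, card_powersetCard, card_univ, Fintype.card_fin]
  simp only [nsmul_eq_mul]
  ring

theorem sum_cliq_edg (n t : ℕ) :
      2 ^ Fintype.card (Sym2 (Fin n)) * (n.choose t) * (1 / 2) ^ ((t + 1).choose 2)
        * ((n : ℝ) * (n - 1) / 4) ≤
    ∑ w : Finset (Sym2 (Fin n)), ((cliq t w).card : ℝ) * ((edg w).card : ℝ) := by
  have h0 : ∀ w : Finset (Sym2 (Fin n)), ((cliq t w).card : ℝ) * ((edg w).card : ℝ) =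
      ∑ S ∈ powersetCard t (univ : Finset (Fin n)),
        ∑ d ∈ univ.filter (fun d : Sym2 (Fin n) => ¬ d.IsDiag),
          (((if insert d S.sym2 ⊆ w then 1 else 0 : ℕ)) : ℝ) := by
    intro w
    simp only [cliq, edg, card_filter (fun S : Finset (Fin n) => S.sym2 ⊆ w),
      card_filter (fun d : Sym2 (Fin n) => d ∈ w), Nat.cast_sum]
    rw [sum_mul_sum]
    refine sum_congr rfl fun S _ => sum_congr rfl fun d _ => ?_
    simp only [insert_subset_iff]
    by_cases h1 : S.sym2 ⊆ w <;> by_cases h2 : d ∈ w <;> simp [h1, h2]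
  simp only [h0]
  rw [sum_comm]
  have h1 : ∀ S ∈ powersetCard t (univ : Finset (Fin n)),
      (n.choose 2 : ℝ) * (2 ^ Fintype.card (Sym2 (Fin n)) * (1 / 2) ^ ((t + 1).choose 2 + 1)) ≤
      ∑ w : Finset (Sym2 (Fin n)), ∑ d ∈ univ.filter (fun d : Sym2 (Fin n) => ¬ d.IsDiag),
          (((if insert d S.sym2 ⊆ w then 1 else 0 : ℕ)) : ℝ) := by
    intro S hS
    rw [sum_comm, ← nondiag_card, ← nsmul_eq_mul]
    refine card_nsmul_le_sum _ _ _ fun d _ => ?_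
    rw [← Nat.cast_sum, ← card_filter, card_supersets]
    refine mul_le_mul_of_nonneg_left ?_ (by positivity)
    refine pow_le_pow_of_le_one (by norm_num) (by norm_num) ?_
    refine (card_insert_le _ _).trans ?_
    rw [card_sym2, (mem_powersetCard.mp hS).2]
  have h2 := card_nsmul_le_sum _ _ _ h1
  rw [card_powersetCard, card_univ, Fintype.card_fin, nsmul_eq_mul, choose_two_real] at h2
  refine le_trans (le_of_eq ?_) h2
  rw [pow_succ]
  ring

open Classical in
theorem bad_count (n a : ℕ) (hn : 1 ≤ n) (ha : 1 ≤ a) (h : n ^ 3 ≤ 2 ^ a) :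
    ((univ.filter (fun w : Finset (Sym2 (Fin n)) => badPairs a w)).card : ℝ) ≤
      2 ^ Fintype.card (Sym2 (Fin n)) / n := by
  have hn0 : (0 : ℝ) < n := by exact_mod_cast hn
  set P := ((powersetCard a (univ : Finset (Fin n))) ×ˢ
    (powersetCard a (univ : Finset (Fin n)))).filter (fun AB => Disjoint AB.1 AB.2) with hP
  have hsub : univ.filter (fun w : Finset (Sym2 (Fin n)) => badPairs a w) ⊆
      P.biUnion (fun AB => univ.filter
        (fun w => (AB.1 ×ˢ AB.2).image (fun x => s(x.1, x.2)) ⊆ w)) := by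
    intro w hw
    obtain ⟨AB, h1, h2, h3⟩ := (mem_filter.mp hw).2
    exact mem_biUnion.mpr ⟨AB, mem_filter.mpr ⟨h1, h2⟩, mem_filter.mpr ⟨mem_univ _, h3⟩⟩
  have h1 : ((univ.filter (fun w : Finset (Sym2 (Fin n)) => badPairs a w)).card : ℝ) ≤
      ∑ AB ∈ P, ((univ.filter
        (fun w => (AB.1 ×ˢ AB.2).image (fun x => s(x.1, x.2)) ⊆ w)).card : ℝ) := by
    exact_mod_cast (card_le_card hsub).trans card_biUnion_le
  have h2 : ∀ AB ∈ P, ((univ.filter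
        (fun w => (AB.1 ×ˢ AB.2).image (fun x => s(x.1, x.2)) ⊆ w)).card : ℝ) ≤
        2 ^ Fintype.card (Sym2 (Fin n)) * (1 / 2) ^ (a * a) := by
    intro AB hAB
    obtain ⟨hm, hd⟩ := mem_filter.mp hAB
    obtain ⟨hA, hB⟩ := mem_product.mp hm
    have hcard := pair_image_card AB.1 AB.2 hd
    rw [(mem_powersetCard.mp hA).2, (mem_powersetCard.mp hB).2] at hcard
    have := card_supersets ((AB.1 ×ˢ AB.2).image (fun x => s(x.1, x.2)))
    rw [hcard] at this
    refine le_of_eq ?_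
    convert this
  refine h1.trans ((sum_le_card_nsmul _ _ _ h2).trans ?_)
  have hPc : (P.card : ℝ) ≤ (n : ℝ) ^ (2 * a) := by
    have : P.card ≤ n ^ (2 * a) := by
      refine (card_filter_le _ _).trans ?_
      rw [card_product, card_powersetCard, card_univ, Fintype.card_fin, two_mul, pow_add]
      exact Nat.mul_le_mul (Nat.choose_le_pow _ _) (Nat.choose_le_pow _ _)
    exact_mod_cast this
  have hk : (n : ℝ) ^ (2 * a) * n ≤ 2 ^ (a * a) := by
    have : n ^ (2 * a) * n ≤ 2 ^ (a * a) := by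
      calc n ^ (2 * a) * n ≤ n ^ (2 * a) * n ^ a :=
            Nat.mul_le_mul_left _ (Nat.le_self_pow (by omega) n)
        _ = (n ^ 3) ^ a := by rw [← pow_add, ← pow_mul]; congr 1; ring
        _ ≤ (2 ^ a) ^ a := Nat.pow_le_pow_left h a
        _ = 2 ^ (a * a) := by rw [← pow_mul]
    exact_mod_cast this
  rw [nsmul_eq_mul, le_div_iff₀ hn0, one_div, inv_pow]
  have h2a : (0 : ℝ) < 2 ^ (a * a) := by positivity
  calc (P.card : ℝ) * (2 ^ Fintype.card (Sym2 (Fin n)) * ((2 : ℝ) ^ (a * a))⁻¹) * n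
      = 2 ^ Fintype.card (Sym2 (Fin n)) * ((P.card * n) * ((2 : ℝ) ^ (a * a))⁻¹) := by ring
    _ ≤ 2 ^ Fintype.card (Sym2 (Fin n)) * (2 ^ (a * a) * ((2 : ℝ) ^ (a * a))⁻¹) := by
        gcongr
        exact (mul_le_mul_of_nonneg_right hPc hn0.le).trans hk
    _ = _ := by rw [mul_inv_cancel₀ h2a.ne', mul_one]

theorem edg_card_le {n : ℕ} (w : Finset (Sym2 (Fin n))) : ((edg w).card : ℝ) ≤ (n : ℝ) ^ 2 := by
  have : (edg w).card ≤ n ^ 2 := by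
    refine (card_filter_le _ _).trans ?_
    rw [nondiag_card]
    exact Nat.choose_le_pow _ _
  exact_mod_cast this

theorem cliq_card_le {n : ℕ} (t : ℕ) (w : Finset (Sym2 (Fin n))) :
    ((cliq t w).card : ℝ) ≤ (n.choose t : ℝ) := by
  have : (cliq t w).card ≤ n.choose t := by
    refine (card_filter_le _ _).trans ?_
    rw [card_powersetCard, card_univ, Fintype.card_fin]
  exact_mod_cast this

theorem choose_lower (n t : ℕ) (h : 2 * t ≤ n) :
    (n : ℝ) ^ t / (2 ^ t * t.factorial) ≤ (n.choose t : ℝ) := by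
  have h1 : (((n + 1 - t : ℕ) ^ t : ℕ) : ℝ) ≤ (n.choose t : ℝ) * t.factorial := by
    have h2 : (n + 1 - t) ^ t ≤ n.choose t * t.factorial := by
      have := Nat.pow_sub_le_descFactorial n t
      rw [Nat.descFactorial_eq_factorial_mul_choose] at this
      linarith
    exact_mod_cast h2
  have h3 : (n : ℝ) / 2 ≤ ((n + 1 - t : ℕ) : ℝ) := by
    have : n ≤ 2 * (n + 1 - t) := by omega
    have h' : (n : ℝ) ≤ 2 * ((n + 1 - t : ℕ) : ℝ) := by exact_mod_cast this
    linarith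
  have h4 : ((n : ℝ) / 2) ^ t ≤ ((n + 1 - t : ℕ) : ℝ) ^ t := by gcongr
  rw [div_pow] at h4
  push_cast at h1
  have hf : (0 : ℝ) < t.factorial := by exact_mod_cast t.factorial_pos
  rw [← div_div, div_le_iff₀ hf]
  exact h4.trans h1

open Classical in
theorem exists_good (t : ℕ) (n a : ℕ) (p c : ℝ) (hp : p = (1 / 2) ^ ((t + 1).choose 2))
    (hc0 : 0 ≤ c)
    (hc : c * (2 ^ t * t.factorial) ≤ p / 64) (hn : 4 ≤ n) (ht : 2 * t ≤ n)
    (hnp : 64 ≤ (n : ℝ) * p) (ha : 1 ≤ a) (h : n ^ 3 ≤ 2 ^ a) :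
    ∃ w : Finset (Sym2 (Fin n)), (n : ℝ) ^ 2 / 8 ≤ (edg w).card ∧ ¬ badPairs a w ∧
      c * (n : ℝ) ^ t ≤ (cliq t w).card := by
  by_contra! hcon
  have hf : (0 : ℝ) < 2 ^ t * t.factorial := by positivity
  have hn0 : (0 : ℝ) < n := by exact_mod_cast (by omega : 0 < n)
  have hlow := choose_lower n t ht
  have hp0 : 0 < p := by rw [hp]; positivity
  have hC : (0 : ℝ) < n.choose t := lt_of_lt_of_le (by positivity) hlow
  have hterm : ∀ w : Finset (Sym2 (Fin n)),
      ((cliq t w).card : ℝ) * (edg w).card - (cliq t w).card * ((n : ℝ) ^ 2 / 8) ≤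
      (n.choose t) * (n : ℝ) ^ 2 * (if badPairs a w then 1 else 0 : ℕ) +
        c * (n : ℝ) ^ t * (n : ℝ) ^ 2 := by
    intro w
    have hx0 : (0 : ℝ) ≤ (cliq t w).card := by positivity
    have he0 : (0 : ℝ) ≤ (edg w).card := by positivity
    have hx := cliq_card_le t w
    have he := edg_card_le w
    have hcn : 0 ≤ c * (n : ℝ) ^ t * (n : ℝ) ^ 2 := by positivity
    have hq : 0 ≤ (cliq t w).card * ((n : ℝ) ^ 2 / 8) := by positivity
    by_cases hb : badPairs a w
    · have := mul_le_mul hx he he0 hC.le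
      simp only [hb, if_true]
      push_cast
      linarith
    · simp only [hb, if_false]
      push_cast
      by_cases hee : (n : ℝ) ^ 2 / 8 ≤ (edg w).card
      · have h1 := hcon w hee hb
        have := mul_le_mul h1.le he he0 (by positivity)
        linarith
      · have := mul_le_mul_of_nonneg_left (not_le.mp hee).le hx0
        linarith
  have hsum := sum_le_sum (s := univ) fun w _ => hterm w
  rw [sum_sub_distrib, ← sum_mul, sum_cliq, sum_add_distrib, ← mul_sum, ← Nat.cast_sum,
    ← card_filter, sum_const, card_univ, Fintype.card_finset, nsmul_eq_mul] at hsum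
  have hce := sum_cliq_edg n t
  rw [← hp] at hsum hce
  push_cast at hsum
  refine final_arith (n.choose t) (2 ^ Fintype.card (Sym2 (Fin n))) p n ((n : ℝ) ^ t) c _ hC
    (by positivity) hp0 (by exact_mod_cast hn) hnp ?_ (bad_count n a (by omega) ha h) ?_
  · rw [div_le_iff₀ hf] at hlow
    calc c * (n : ℝ) ^ t ≤ c * (n.choose t * (2 ^ t * t.factorial)) := by gcongr
      _ = n.choose t * (c * (2 ^ t * t.factorial)) := by ring
      _ ≤ n.choose t * (p / 64) := by gcongr
      _ = _ := by ring
  · refine le_trans ?_ hsum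
    rw [mul_sub]
    linarith

end

/-- For every `t ≥ 1` there exist `c_t > 0` and `n₀` such that for all `n ≥ n₀` there is a
graph `H` on `n` vertices with at least `n²/8` edges, no `K_{a,a}` for `a ≥ 3·log₂ n`,
and at least `c_t · n^t` cliques of size `t`. -/
theorem exists_bad_graph (t : ℕ) (ht : 0 < t) :
    ∃ c : ℝ, 0 < c ∧ ∃ n₀ : ℕ, ∀ n : ℕ, n₀ ≤ n →
      ∃ H : SimpleGraph (Fin n),
        (n : ℝ) ^ 2 / 8 ≤ (Nat.card H.edgeSet : ℝ) ∧
        (∀ a : ℕ, 3 * Real.logb 2 n ≤ (a : ℝ) → ¬ ContainsBiclique H a) ∧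
        c * (n : ℝ) ^ t ≤ ({s : Finset (Fin n) | H.IsNClique t s}.ncard : ℝ) := by
  obtain ⟨p, hp⟩ : ∃ p : ℝ, p = (1 / 2) ^ ((t + 1).choose 2) := ⟨_, rfl⟩
  have hp0 : 0 < p := by rw [hp]; positivity
  have hf : (0 : ℝ) < 2 ^ t * t.factorial := by positivity
  refine ⟨p / 64 / (2 ^ t * t.factorial), by positivity, 4 + 2 * t + ⌈64 / p⌉₊, ?_⟩
  intro n hn
  have hnp : 64 ≤ (n : ℝ) * p := by
    rw [← div_le_iff₀ hp0]
    refine (Nat.le_ceil _).trans ?_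
    exact_mod_cast (by omega : ⌈64 / p⌉₊ ≤ n)
  have hn0 : (0 : ℝ) < n := by exact_mod_cast (by omega : 0 < n)
  have hn3 : 1 < n ^ 3 := Nat.one_lt_pow (by norm_num) (by omega)
  obtain ⟨w, he, hb, hc⟩ := exists_good t n (Nat.clog 2 (n ^ 3)) p
    (p / 64 / (2 ^ t * t.factorial)) hp (by positivity)
    (by rw [div_mul_cancel₀ _ hf.ne']) (by omega) (by omega) hnp
    (Nat.clog_pos (by norm_num) hn3) (Nat.le_pow_clog (by norm_num) _)
  refine ⟨SimpleGraph.fromEdgeSet (w : Set (Sym2 (Fin n))), ?_, ?_, ?_⟩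
  · refine he.trans (le_of_eq ?_)
    have : (SimpleGraph.fromEdgeSet (w : Set (Sym2 (Fin n)))).edgeSet = (edg w : Set _) := by
      ext d
      simp [edg, and_comm]
    rw [this]
    simp
  · rintro a ha ⟨A, B, hd, hA, hB, hAB⟩
    have hca : Nat.clog 2 (n ^ 3) ≤ a := by
      refine Nat.clog_le_of_le_pow ?_
      have h1 : Real.logb 2 ((n : ℝ) ^ 3) ≤ a := by
        rw [Real.logb_pow]; exact_mod_cast ha
      rw [Real.logb_le_iff_le_rpow (by norm_num) (by positivity), Real.rpow_natCast] at h1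
      exact_mod_cast h1
    obtain ⟨A', hA', hA'c⟩ := Finset.exists_subset_card_eq (hA.symm ▸ hca)
    obtain ⟨B', hB', hB'c⟩ := Finset.exists_subset_card_eq (hB.symm ▸ hca)
    refine hb ⟨(A', B'), ?_, ?_, ?_⟩
    · simp [Finset.mem_powersetCard, hA'c, hB'c]
    · exact Finset.disjoint_of_subset_left hA' (Finset.disjoint_of_subset_right hB' hd)
    · intro d hd
      obtain ⟨⟨x, y⟩, hxy, rfl⟩ := Finset.mem_image.mp hd
      obtain ⟨hx, hy⟩ := Finset.mem_product.mp hxy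
      have := hAB x (hA' hx) y (hB' hy)
      rw [SimpleGraph.fromEdgeSet_adj] at this
      exact_mod_cast this.1
  · refine hc.trans ?_
    rw [← Set.ncard_coe_finset (cliq t w)]
    have : ((cliq t w : Finset _) : Set (Finset (Fin n))) ⊆
      {s | (SimpleGraph.fromEdgeSet (w : Set (Sym2 (Fin n)))).IsNClique t s} := by
      intro S hS
      obtain ⟨h1, h2⟩ := Finset.mem_filter.mp (Finset.mem_coe.mp hS)
      refine ⟨?_, (Finset.mem_powersetCard.mp h1).2⟩
      intro x hx y hy hxy
      rw [SimpleGraph.fromEdgeSet_adj]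
      refine ⟨?_, hxy⟩
      exact_mod_cast h2 (Finset.mk_mem_sym2_iff.mpr ⟨hx, hy⟩)
    exact_mod_cast Set.ncard_le_ncard this (Set.toFinite _)
end

section
/- Let k be a positive integer, let G = (V,E) be a finite simple graph with t vertices, and let W ⊆ V be a set of 2k+1 vertices of G having no balanced k-separator. Let H be a graph on n ≥ 2 vertices containing no complete bipartite subgraph K_{a,a} for any integer a ≥ 3·log₂(n). Let R ⊆ Hom(G,H) be a W-balanced rectangle. Then |R| ≤ n^{t − ⌊k/3⌋} · (3·log₂(n))^{⌊k/3⌋}. -/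
/-- The set of graph homomorphisms from `G` to `H`, viewed as functions. -/
def HomSet {V U : Type*} (G : SimpleGraph V) (H : SimpleGraph U) : Set (V → U) :=
  {h | ∀ ⦃u v : V⦄, G.Adj u v → H.Adj (h u) (h v)}

/-- `R` is an `(X, Y)`-rectangle: for all `f, g ∈ R` the function agreeing with `f` on `X`
and with `g` on `Y` also belongs to `R`. -/
def IsRectangle {V U : Type*} (X Y : Set V) (R : Set (V → U)) : Prop :=
  ∀ f ∈ R, ∀ g ∈ R, ∃ h ∈ R, (∀ v ∈ X, h v = f v) ∧ (∀ v ∈ Y, h v = g v)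

theorem brs_separator {V : Type*} [Fintype V] (G : SimpleGraph V) (k : ℕ) (hk : 0 < k)
    (W X Y Z : Set V) (hWcard : W.ncard = 2 * k + 1) (hXY : IsWBalancedPartition W X Y)
    (hcov : ∀ x ∈ X, ∀ y ∈ Y, G.Adj x y → x ∈ Z ∨ y ∈ Z) (hZ : Z.ncard < k / 3) :
    ∃ S : Set V, S.ncard ≤ k ∧ IsBalancedSeparator G W S := by
  obtain ⟨hU, hD, hX, hY⟩ := hXY
  have hsum : (X ∩ W).ncard + (Y ∩ W).ncard = 2 * k + 1 := by
    rw [← Set.ncard_union_eq (hD.mono Set.inter_subset_left Set.inter_subset_left),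
      ← Set.union_inter_distrib_right, hU, Set.univ_inter, hWcard]
  obtain ⟨T, hTs, hT⟩ := Set.exists_subset_card_eq (s := X ∩ W) (n := (X ∩ W).ncard - k) (by omega)
  obtain ⟨T', hTs', hT'⟩ :=
    Set.exists_subset_card_eq (s := Y ∩ W) (n := (Y ∩ W).ncard - k) (by omega)
  have hmem : ∀ v, v ∈ X ∨ v ∈ Y := fun v => by
    have : v ∈ X ∪ Y := hU ▸ Set.mem_univ v
    exact this
  have hnot : ∀ v, v ∈ X → v ∈ Y → False := fun v h1 h2 => Set.disjoint_left.mp hD h1 h2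
  refine ⟨Z ∪ (T ∪ T'), ?_, ?_⟩
  · have h1 := Set.ncard_union_le Z (T ∪ T')
    have h2 := Set.ncard_union_le T T'
    omega
  · intro C
    induction C using SimpleGraph.ConnectedComponent.ind with
    | h v0 =>
    have step : ∀ a b : ↥((Z ∪ (T ∪ T'))ᶜ), (G.induce (Z ∪ (T ∪ T'))ᶜ).Reachable a b →
        ((a : V) ∈ X ↔ (b : V) ∈ X) := by
      rintro a b ⟨w⟩
      induction w with
      | nil => rfl
      | @cons a b c hab _ ih =>
        rw [← ih]
        have hab' : G.Adj a b := hab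
        have ha : (a : V) ∉ Z := fun h => a.2 (Or.inl h)
        have hb : (b : V) ∉ Z := fun h => b.2 (Or.inl h)
        constructor
        · intro h
          rcases hmem b with h' | h'
          · exact h'
          · rcases hcov _ h _ h' hab' with h | h <;> contradiction
        · intro h
          rcases hmem a with h' | h'
          · exact h'
          · rcases hcov _ h _ h' hab'.symm with h | h <;> contradiction
    rw [hWcard]
    rcases hmem v0 with h0 | h0
    · have hsub : componentSupp G (Z ∪ (T ∪ T')) ((G.induce _).connectedComponentMk v0) ∩ W
          ⊆ (X ∩ W) \ T := by
        rintro u ⟨⟨hu, hc⟩, huW⟩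
        have := step _ _ (SimpleGraph.ConnectedComponent.exact hc)
        exact ⟨⟨this.mpr h0, huW⟩, fun h => hu (Or.inr (Or.inl h))⟩
      have h1 := Set.ncard_le_ncard hsub
      have h2 := Set.ncard_diff hTs
      omega
    · have hsub : componentSupp G (Z ∪ (T ∪ T')) ((G.induce _).connectedComponentMk v0) ∩ W
          ⊆ (Y ∩ W) \ T' := by
        rintro u ⟨⟨hu, hc⟩, huW⟩
        have := step _ _ (SimpleGraph.ConnectedComponent.exact hc)
        refine ⟨⟨?_, huW⟩, fun h => hu (Or.inr (Or.inr h))⟩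
        rcases hmem u with h | h
        · exact (hnot _ (this.mp h) h0).elim
        · exact h
      have h1 := Set.ncard_le_ncard hsub
      have h2 := Set.ncard_diff hTs'
      omega

/-- Every `W`-balanced rectangle contained in `Hom(G, H)` has size at most
`n^(t - ⌊k/3⌋) · (3 log₂ n)^(⌊k/3⌋)`. -/
theorem balanced_rectangle_small {V U : Type*} [Fintype V] [Fintype U]
    (G : SimpleGraph V) (H : SimpleGraph U) (k t n : ℕ) (hk : 0 < k)
    (ht : Fintype.card V = t) (hn : Fintype.card U = n) (hn2 : 2 ≤ n)
    (W : Set V) (hWcard : W.ncard = 2 * k + 1)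
    (hW : ¬ ∃ S : Set V, S.ncard ≤ k ∧ IsBalancedSeparator G W S)
    (hH : ∀ a : ℕ, 3 * Real.logb 2 n ≤ (a : ℝ) → ¬ ContainsBiclique H a)
    (R : Set (V → U)) (hRhom : R ⊆ HomSet G H)
    (hRrect : ∃ X Y : Set V, IsWBalancedPartition W X Y ∧ IsRectangle X Y R) :
    (R.ncard : ℝ) ≤ (n : ℝ) ^ (t - k / 3) * (3 * Real.logb 2 n) ^ (k / 3) := by
  classical
  obtain ⟨X, Y, hXY, hR⟩ := hRrect
  set L : ℝ := 3 * Real.logb 2 n with hL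
  have hL0 : 0 ≤ L := by
    have : 0 ≤ Real.logb 2 n := Real.logb_nonneg (by norm_num) (by exact_mod_cast (by omega))
    positivity
  let I : V → Finset U := fun v => R.toFinset.image (fun f => f v)
  let Z : Finset V := Finset.univ.filter (fun v => ((I v).card : ℝ) ≤ L)
  have hcov : ∀ x ∈ X, ∀ y ∈ Y, G.Adj x y → x ∈ (Z : Set V) ∨ y ∈ (Z : Set V) := by
    intro x hx y hy hxy
    by_contra hcon
    push Not at hcon
    simp only [Z, Finset.coe_filter, Finset.mem_univ, true_and, Set.mem_ofPred_eq, not_le] at hcon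
    have hadj : ∀ u ∈ I x, ∀ v ∈ I y, H.Adj u v := by
      intro u hu v hv
      simp only [I, Finset.mem_image, Set.mem_toFinset] at hu hv
      obtain ⟨f, hf, rfl⟩ := hu
      obtain ⟨g, hg, rfl⟩ := hv
      obtain ⟨h, hh, h1, h2⟩ := hR f hf g hg
      rw [← h1 x hx, ← h2 y hy]
      exact hRhom hh hxy
    obtain ⟨A, hA, hAc⟩ := Finset.exists_subset_card_eq (s := I x) (n := ⌈L⌉₊)
      (Nat.ceil_le.mpr hcon.1.le)
    obtain ⟨B, hB, hBc⟩ := Finset.exists_subset_card_eq (s := I y) (n := ⌈L⌉₊)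
      (Nat.ceil_le.mpr hcon.2.le)
    refine hH ⌈L⌉₊ (Nat.le_ceil L) ⟨A, B, ?_, hAc, hBc, fun u hu v hv => hadj u (hA hu) v (hB hv)⟩
    rw [Finset.disjoint_left]
    exact fun u hu hv => (hadj u (hA hu) u (hB hv)).ne rfl
  have hZ : k / 3 ≤ Z.card := by
    by_contra hlt
    exact hW (brs_separator G k hk W X Y Z hWcard hXY hcov
      (by rw [Set.ncard_coe_finset]; omega))
  obtain ⟨Q, hQ, hQc⟩ := Finset.exists_subset_card_eq hZ
  have hcard : R.ncard ≤ ∏ v, (I v).card := by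
    rw [Set.ncard_eq_toFinset_card', ← Fintype.card_piFinset]
    apply Finset.card_le_card
    intro f hf
    rw [Fintype.mem_piFinset]
    exact fun v => Finset.mem_image_of_mem _ hf
  calc (R.ncard : ℝ) ≤ ∏ v, ((I v).card : ℝ) := by exact_mod_cast hcard
    _ = (∏ v ∈ Qᶜ, ((I v).card : ℝ)) * ∏ v ∈ Q, ((I v).card : ℝ) :=
        (Finset.prod_compl_mul_prod Q _).symm
    _ ≤ (∏ v ∈ Qᶜ, (n : ℝ)) * ∏ v ∈ Q, L := by
        refine mul_le_mul (Finset.prod_le_prod (fun _ _ => by positivity) fun v _ => ?_)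
          (Finset.prod_le_prod (fun _ _ => by positivity) fun v hv => ?_)
          (Finset.prod_nonneg fun _ _ => by positivity)
          (Finset.prod_nonneg fun _ _ => by positivity)
        · rw [← hn]; exact_mod_cast Finset.card_le_univ _
        · exact (Finset.mem_filter.mp (hQ hv)).2
    _ = _ := by
        rw [Finset.prod_const, Finset.prod_const, Finset.card_compl, hQc, ht]
end

section
/- Let k be a positive integer, let G = (V,E) be a finite simple graph with t vertices, and let W ⊆ V be a set of 2k+1 vertices of G having no balanced k-separator. Let H be a graph on n ≥ 2 vertices containing no complete bipartite subgraph K_{a,a} for any integer a ≥ 3·log₂(n), and suppose H contains at least m cliques of size t. Then every family (R_i)_{i ∈ I} of W-balanced rectangles whose union equals Hom(G,H) satisfies |I| ≥ t! · m / (n^{t − ⌊k/3⌋} · (3·log₂(n))^{⌊k/3⌋}). -/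
/-- `R` is a `W`-balanced rectangle. -/
def IsWBalancedRectangle {V U : Type*} (W : Set V) (R : Set (V → U)) : Prop :=
  ∃ X Y : Set V, IsWBalancedPartition W X Y ∧ IsRectangle X Y R

/-- A set covering all cross edges of a `W`-balanced partition is large. -/
lemma cover_large {V : Type*} [Finite V] (G : SimpleGraph V) (k : ℕ)
    (W : Set V) (hWcard : W.ncard = 2 * k + 1)
    (hW : ¬ ∃ S : Set V, S.ncard ≤ k ∧ IsBalancedSeparator G W S)
    (X Y : Set V) (hXY : IsWBalancedPartition W X Y) (Z : Set V)
    (hZ : ∀ x ∈ X, ∀ y ∈ Y, G.Adj x y → x ∈ Z ∨ y ∈ Z) : k / 3 ≤ Z.ncard := by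
  by_contra hlt
  push Not at hlt
  obtain ⟨hU, hD, hX, hY⟩ := hXY
  have hsum : (X ∩ W).ncard + (Y ∩ W).ncard = 2 * k + 1 := by
    rw [← hWcard, ← Set.ncard_union_eq (hD.mono Set.inter_subset_left Set.inter_subset_left)
      (Set.toFinite _) (Set.toFinite _), ← Set.union_inter_distrib_right, hU, Set.univ_inter]
  have key : ∃ T : Set V, T.ncard ≤ (k + 2) / 3 ∧ ((X ∩ W) \ T).ncard ≤ k ∧
      ((Y ∩ W) \ T).ncard ≤ k := by
    have aux : ∀ P Q : Set V, P.ncard + Q.ncard = 2 * k + 1 → 2 * k + 1 ≤ 3 * Q.ncard →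
        Q.ncard ≤ P.ncard → ∃ T : Set V, T.ncard ≤ (k + 2) / 3 ∧ (P \ T).ncard ≤ k ∧
          (Q \ T).ncard ≤ k := by
      intro P Q h1 h2 h3
      obtain ⟨T, hTP, hT⟩ := Set.exists_subset_card_eq (s := P) (n := P.ncard - k) (by omega)
      refine ⟨T, by omega, ?_, ?_⟩
      · rw [Set.ncard_sdiff hTP (Set.toFinite _)]; omega
      · have := Set.ncard_le_ncard (Set.diff_subset : Q \ T ⊆ Q) (Set.toFinite _)
        omega
    rcases le_total (Y ∩ W).ncard (X ∩ W).ncard with h | h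
    · exact aux _ _ hsum (by omega) h
    · obtain ⟨T, a, b, c⟩ := aux _ _ (by omega : (Y ∩ W).ncard + (X ∩ W).ncard = 2 * k + 1)
        (by omega) h
      exact ⟨T, a, c, b⟩
  obtain ⟨T, hT, hTX, hTY⟩ := key
  apply hW
  refine ⟨Z ∪ T, ?_, ?_⟩
  · have := Set.ncard_union_le Z T
    omega
  · intro C
    have hmem : ∀ v, v ∈ X ∨ v ∈ Y := fun v => by
      have : v ∈ X ∪ Y := by rw [hU]; trivial
      exact this
    have hadj : ∀ u v : ((Z ∪ T)ᶜ : Set V), (G.induce (Z ∪ T)ᶜ).Adj u v →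
        (u.1 ∈ X ↔ v.1 ∈ X) := by
      intro u v huv
      have h : G.Adj u.1 v.1 := huv
      have hu : u.1 ∉ Z := fun h => u.2 (Or.inl h)
      have hv : v.1 ∉ Z := fun h => v.2 (Or.inl h)
      constructor
      · intro hx
        rcases hmem v.1 with h' | h'
        · exact h'
        · rcases hZ _ hx _ h' h with h'' | h''
          · exact absurd h'' hu
          · exact absurd h'' hv
      · intro hx
        rcases hmem u.1 with h' | h'
        · exact h'
        · rcases hZ _ hx _ h' h.symm with h'' | h''
          · exact absurd h'' hv
          · exact absurd h'' hu
    have hreach : ∀ u v : ((Z ∪ T)ᶜ : Set V), (G.induce (Z ∪ T)ᶜ).Reachable u v →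
        (u.1 ∈ X ↔ v.1 ∈ X) := by
      rintro u v ⟨p⟩
      induction p with
      | nil => rfl
      | cons h p ih => exact (hadj _ _ h).trans ih
    have hsub : componentSupp G (Z ∪ T) C ∩ W ⊆ (X ∩ W) \ T ∨
        componentSupp G (Z ∪ T) C ∩ W ⊆ (Y ∩ W) \ T := by
      induction C using SimpleGraph.ConnectedComponent.ind with
      | h c =>
        by_cases hc : c.1 ∈ X
        · left
          rintro v ⟨⟨hv, hvC⟩, hvW⟩
          have := hreach _ _ (SimpleGraph.ConnectedComponent.eq.1 hvC)
          exact ⟨⟨this.2 hc, hvW⟩, fun h => hv (Or.inr h)⟩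
        · right
          rintro v ⟨⟨hv, hvC⟩, hvW⟩
          have := hreach _ _ (SimpleGraph.ConnectedComponent.eq.1 hvC)
          exact ⟨⟨(hmem v).resolve_left (fun h => hc (this.1 h)), hvW⟩, fun h => hv (Or.inr h)⟩
    rcases hsub with h | h
    · have := Set.ncard_le_ncard h (Set.toFinite _)
      omega
    · have := Set.ncard_le_ncard h (Set.toFinite _)
      omega

/-- Size bound for one rectangle. -/
lemma rect_small {V U : Type*} [Fintype V] [Fintype U]
    (G : SimpleGraph V) (H : SimpleGraph U) (k : ℕ) (L : ℝ)
    (W : Set V) (hWcard : W.ncard = 2 * k + 1)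
    (hW : ¬ ∃ S : Set V, S.ncard ≤ k ∧ IsBalancedSeparator G W S)
    (hH : ∀ a : ℕ, L ≤ (a : ℝ) → ¬ ContainsBiclique H a)
    (R : Set (V → U)) (hR : IsWBalancedRectangle W R) (hsub : R ⊆ HomSet G H) :
    (R.ncard : ℝ) ≤ (Fintype.card U : ℝ) ^ (Fintype.card V - k / 3) * L ^ (k / 3) := by
  classical
  obtain ⟨X, Y, hXY, hrect⟩ := hR
  let P : V → Finset U := fun v => Finset.univ.filter (fun u => ∃ f ∈ R, f v = u)
  let Z : Finset V := Finset.univ.filter (fun v => ((P v).card : ℝ) < L)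
  have hZ : k / 3 ≤ Z.card := by
    rw [← Set.ncard_coe_finset]
    refine cover_large G k W hWcard hW X Y hXY _ ?_
    intro x hx y hy hxy
    have hbi : ∀ u ∈ P x, ∀ v ∈ P y, H.Adj u v := by
      intro u hu v hv
      simp only [P, Finset.mem_filter, Finset.mem_univ, true_and] at hu hv
      obtain ⟨f, hf, rfl⟩ := hu
      obtain ⟨g, hg, rfl⟩ := hv
      obtain ⟨h, hh, h1, h2⟩ := hrect f hf g hg
      rw [← h1 x hx, ← h2 y hy]
      exact hsub hh hxy
    by_contra hcon
    push Not at hcon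
    simp only [Z, Finset.coe_filter, Finset.mem_univ, true_and, Set.mem_ofPred_eq, not_lt] at hcon
    obtain ⟨A, hA, hAc⟩ := Finset.exists_subset_card_eq (min_le_left (P x).card (P y).card)
    obtain ⟨B, hB, hBc⟩ := Finset.exists_subset_card_eq (min_le_right (P x).card (P y).card)
    refine hH (min (P x).card (P y).card) ?_ ⟨A, B, ?_, hAc, hBc,
      fun u hu v hv => hbi u (hA hu) v (hB hv)⟩
    · push_cast
      exact le_min hcon.1 hcon.2
    · rw [Finset.disjoint_left]
      intro u hu hv
      exact (hbi u (hA hu) u (hB hv)).ne rfl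
  obtain ⟨Z', hZ', hc⟩ := Finset.exists_subset_card_eq hZ
  have hRP : R.ncard ≤ (Fintype.piFinset P).card := by
    rw [← Set.ncard_coe_finset]
    apply Set.ncard_le_ncard _ (Set.toFinite _)
    intro f hf
    simp only [Finset.mem_coe, Fintype.mem_piFinset, P, Finset.mem_filter, Finset.mem_univ,
      true_and]
    exact fun v => ⟨f, hf, rfl⟩
  calc (R.ncard : ℝ) ≤ ((Fintype.piFinset P).card : ℝ) := by exact_mod_cast hRP
    _ = ∏ v, ((P v).card : ℝ) := by rw [Fintype.card_piFinset]; push_cast; rfl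
    _ = (∏ v ∈ Z'ᶜ, ((P v).card : ℝ)) * ∏ v ∈ Z', ((P v).card : ℝ) :=
        (Finset.prod_compl_mul_prod _ _).symm
    _ ≤ (Fintype.card U : ℝ) ^ (Z'ᶜ).card * L ^ Z'.card := by
        refine mul_le_mul ?_ ?_ ?_ ?_
        · rw [← Finset.prod_const]
          exact Finset.prod_le_prod (fun _ _ => by positivity)
            (fun v _ => by exact_mod_cast Finset.card_le_univ _)
        · rw [← Finset.prod_const]
          exact Finset.prod_le_prod (fun _ _ => by positivity)
            (fun v hv => (Finset.mem_filter.1 (hZ' hv)).2.le)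
        · positivity
        · positivity
    _ = _ := by rw [Finset.card_compl, hc]

/-- Lower bound on the number of homomorphisms. -/
lemma hom_large {V U : Type*} [Fintype V] [Fintype U]
    (G : SimpleGraph V) (H : SimpleGraph U) :
    (Fintype.card V).factorial * {s : Finset U | H.IsNClique (Fintype.card V) s}.ncard ≤
      (HomSet G H).ncard := by
  classical
  let F : Finset (Finset U) := Finset.univ.filter (fun s => H.IsNClique (Fintype.card V) s)
  have hF : {s : Finset U | H.IsNClique (Fintype.card V) s}.ncard = F.card := by
    rw [← Set.ncard_coe_finset]; simp [F]
  rw [hF, mul_comm]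
  let e : ∀ s : F, V ≃ s.1 := fun s => Fintype.equivOfCardEq (by
    have := (Finset.mem_filter.1 s.2).2.card_eq
    simp [this])
  let φ : F × Equiv.Perm V → (V → U) := fun p v => (e p.1 (p.2 v) : U)
  have hφ : Function.Injective φ := by
    rintro ⟨s, σ⟩ ⟨s', σ'⟩ h
    have himg : ∀ (s : F) (σ : Equiv.Perm V) , Set.range (φ (s, σ)) = (s.1 : Set U) := by
      intro s σ
      ext u
      constructor
      · rintro ⟨v, rfl⟩
        exact (e s (σ v)).2
      · intro hu
        exact ⟨σ.symm ((e s).symm ⟨u, hu⟩), by simp [φ]⟩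
    have hs : s = s' := by
      apply Subtype.ext
      apply Finset.coe_injective
      rw [← himg s σ, ← himg s' σ', h]
    subst hs
    congr 1
    ext v
    have := congrFun h v
    exact (e s).injective (Subtype.ext this)
  have hcard : Fintype.card (F × Equiv.Perm V) = F.card * (Fintype.card V).factorial := by
    rw [Fintype.card_prod, Fintype.card_perm, Fintype.card_coe]
  rw [← hcard, ← Nat.card_eq_fintype_card, ← Set.ncard_univ, ← Set.ncard_image_of_injective _ hφ]
  apply Set.ncard_le_ncard _ (Set.toFinite _)
  rintro _ ⟨⟨s, σ⟩, -, rfl⟩ u v huv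
  have hcl := (Finset.mem_filter.1 s.2).2.isClique
  refine hcl (e s (σ u)).2 (e s (σ v)).2 ?_
  intro h
  exact huv.ne (σ.injective ((e s).injective (Subtype.ext h)))

/-- Any family of `W`-balanced rectangles covering `Hom(G, H)` must have at least
`t! · m / (n^(t - ⌊k/3⌋) · (3 log₂ n)^(⌊k/3⌋))` members. -/
theorem balanced_rectangle_cover_large {V U I : Type*} [Fintype V] [Fintype U] [Fintype I]
    (G : SimpleGraph V) (H : SimpleGraph U) (k t n m : ℕ) (hk : 0 < k)
    (ht : Fintype.card V = t) (hn : Fintype.card U = n) (hn2 : 2 ≤ n)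
    (W : Set V) (hWcard : W.ncard = 2 * k + 1)
    (hW : ¬ ∃ S : Set V, S.ncard ≤ k ∧ IsBalancedSeparator G W S)
    (hH : ∀ a : ℕ, 3 * Real.logb 2 n ≤ (a : ℝ) → ¬ ContainsBiclique H a)
    (hm : m ≤ {s : Finset U | H.IsNClique t s}.ncard)
    (R : I → Set (V → U))
    (hrect : ∀ i, IsWBalancedRectangle W (R i))
    (hcover : ⋃ i, R i = HomSet G H) :
    (t.factorial * m : ℝ) / ((n : ℝ) ^ (t - k / 3) * (3 * Real.logb 2 n) ^ (k / 3)) ≤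
      (Fintype.card I : ℝ) := by
  classical
  subst ht hn
  have hlog : (1 : ℝ) ≤ Real.logb 2 (Fintype.card U) := by
    rw [Real.le_logb_iff_rpow_le (by norm_num) (by positivity)]
    simpa using (by exact_mod_cast hn2 : (2 : ℝ) ≤ Fintype.card U)
  have hpos : (0 : ℝ) < Fintype.card U := by positivity
  rw [div_le_iff₀ (by positivity)]
  have h1 : ((Fintype.card V).factorial * m : ℝ) ≤ ((HomSet G H).ncard : ℝ) := by
    exact_mod_cast (Nat.mul_le_mul_left _ hm).trans (hom_large G H)
  have h2 : (HomSet G H).ncard ≤ ∑ i, (R i).ncard := by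
    rw [← hcover]
    have h := Finset.card_biUnion_le (s := (Finset.univ : Finset I))
      (t := fun i => (R i).toFinset)
    simp only [← Set.ncard_eq_toFinset_card'] at h
    rw [← Set.ncard_coe_finset] at h
    simpa using h
  have h3 : ∀ i, ((R i).ncard : ℝ) ≤ _ := fun i =>
    rect_small G H k _ W hWcard hW hH (R i) (hrect i)
      (hcover ▸ Set.subset_iUnion R i)
  calc ((Fintype.card V).factorial * m : ℝ) ≤ ((HomSet G H).ncard : ℝ) := h1
    _ ≤ ∑ i, ((R i).ncard : ℝ) := by exact_mod_cast h2
    _ ≤ _ := Finset.sum_le_card_nsmul _ _ _ (fun i _ => h3 i)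
    _ = _ := by rw [Finset.card_univ, nsmul_eq_mul]
end
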